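/- Let X be a reflexive Banach space with a finite-dimensional decomposition which has the restricted QHI property. Then the dual of every infinite-dimensional FDD-block subspace of X is hereditarily indecomposable; in particular X^* is hereditarily indecomposable. -/

import Mathlib

open Filter Topology

noncomputable section

/-- Two subspaces `U`, `V` form a topological direct sum. -/
def IsTopDirectSum {E : Type*} [SeminormedAddCommGroup E] [NormedSpace ℝ E]
    (U V : Submodule ℝ E) : Prop :=
  U ⊓ V = ⊥ ∧ IsClosed ((U ⊔ V : Submodule ℝ E) : Set E) ∧
    ∃ C : ℝ, ∀ u ∈ U, ∀ v ∈ V, ‖u‖ ≤ C * ‖u + v‖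

/-- A Banach space is decomposable if it is the topological direct sum of two
infinite-dimensional closed subspaces. -/
def Decomposable (E : Type*) [SeminormedAddCommGroup E] [NormedSpace ℝ E] : Prop :=
  ∃ U V : Submodule ℝ E, IsClosed (U : Set E) ∧ IsClosed (V : Set E) ∧
    ¬FiniteDimensional ℝ U ∧ ¬FiniteDimensional ℝ V ∧ U ⊔ V = ⊤ ∧ IsTopDirectSum U V

/-- Hereditarily indecomposable space. -/
def IsHI (E : Type*) [SeminormedAddCommGroup E] [NormedSpace ℝ E] : Prop :=
  ¬FiniteDimensional ℝ E ∧
    ∀ Y : Submodule ℝ E, IsClosed (Y : Set E) → ¬ Decomposable ↥Y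

/-- A finite-dimensional decomposition (FDD) of a Banach space: a sequence of nonzero
finite-dimensional subspaces such that every vector has a unique norm-convergent
expansion `x = Σ b n` with `b n ∈ B n`. -/
def IsFDD {E : Type*} [SeminormedAddCommGroup E] [NormedSpace ℝ E]
    (B : ℕ → Submodule ℝ E) : Prop :=
  (∀ n, B n ≠ ⊥) ∧ (∀ n, FiniteDimensional ℝ (B n)) ∧
    ∀ x : E, ∃! b : (n : ℕ) → B n,
      Tendsto (fun N => ∑ n ∈ Finset.range N, ((b n : E))) atTop (𝓝 x)

/-- A successive partition of `ℕ` into intervals, encoded by its sequence of left endpoints: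
the `n`-th interval is `[k n, k (n+1))`. -/
def SuccPartition (k : ℕ → ℕ) : Prop :=
  StrictMono k ∧ k 0 = 0

/-- An FDD-block subspace of a space with FDD `B`: the closed span of a sequence of
finitely supported (possibly zero) subspaces `F n` with `ran (F n) ⊆ E n` for some
successive partition. -/
def IsFDDBlockSubspace {E : Type*} [SeminormedAddCommGroup E] [NormedSpace ℝ E]
    (B : ℕ → Submodule ℝ E) (Y : Submodule ℝ E) : Prop :=
  ∃ k : ℕ → ℕ, SuccPartition k ∧ ∃ F : ℕ → Submodule ℝ E,
    (∀ n, F n ≤ ⨆ i ∈ Finset.Ico (k n) (k (n + 1)), B i) ∧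
    Y = (⨆ n, F n).topologicalClosure

/-- The FDD-block quotient of subspace `Σ F n / Σ G n`, as a quotient Banach space. -/
abbrev fddQS {E : Type*} [SeminormedAddCommGroup E] [NormedSpace ℝ E]
    (F G : ℕ → Submodule ℝ E) : Type _ :=
  ↥((⨆ n, F n).topologicalClosure) ⧸
    (((⨆ n, G n).topologicalClosure).comap ((⨆ n, F n).topologicalClosure).subtype)

/-- The restricted QHI property of a space with FDD `B`: no infinite-dimensional
FDD-block quotient of subspace is decomposable. -/
def RestrictedQHI {E : Type*} [SeminormedAddCommGroup E] [NormedSpace ℝ E]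
    (B : ℕ → Submodule ℝ E) : Prop :=
  ∀ k : ℕ → ℕ, SuccPartition k →
    ∀ F G : ℕ → Submodule ℝ E, (∀ n, G n ≤ F n) →
      (∀ n, F n ≤ ⨆ i ∈ Finset.Ico (k n) (k (n + 1)), B i) →
      ¬FiniteDimensional ℝ (fddQS F G) → ¬ Decomposable (fddQS F G)

end

noncomputable section

/-- A Banach space is reflexive when the canonical inclusion in its double dual is onto. -/
def IsReflexiveSpace (E : Type*) [NormedAddCommGroup E] [NormedSpace ℝ E] : Prop :=
  Function.Surjective (NormedSpace.inclusionInDoubleDual ℝ E)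

theorem exists_dual_eq_zero_of_notMem {E : Type*} [NormedAddCommGroup E] [NormedSpace ℝ E]
    (M : Submodule ℝ E) (hM : IsClosed (M : Set E)) {x : E} (hx : x ∉ M) :
    ∃ f : E →L[ℝ] ℝ, (∀ y ∈ M, f y = 0) ∧ f x ≠ 0 := by
  have := hM
  have hne : ‖(M.mkQ x : E ⧸ M)‖ ≠ 0 := by
    rw [norm_ne_zero_iff]
    simpa using hx
  obtain ⟨g, -, hg⟩ := exists_dual_vector ℝ (M.mkQ x : E ⧸ M) hne
  refine ⟨g.comp M.mkQL, fun y hy => ?_, ?_⟩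
  · have : M.mkQ y = 0 := by simpa using hy
    change g (M.mkQ y) = 0
    rw [this, map_zero]
  · change g (M.mkQ x) ≠ 0
    rw [hg]
    simpa using hne

theorem IsReflexiveSpace.exists_eval {E : Type*} [NormedAddCommGroup E] [NormedSpace ℝ E]
    (h : IsReflexiveSpace E) (φ : (E →L[ℝ] ℝ) →L[ℝ] ℝ) : ∃ x : E, ∀ f, φ f = f x := by
  obtain ⟨x, rfl⟩ := h φ
  exact ⟨x, fun f => NormedSpace.dual_def ℝ E x f⟩

/-- A closed subspace of a reflexive space is reflexive. -/
theorem IsReflexiveSpace.submodule {E : Type*} [NormedAddCommGroup E] [NormedSpace ℝ E]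
    (h : IsReflexiveSpace E) (Y : Submodule ℝ E) (hY : IsClosed (Y : Set E)) :
    IsReflexiveSpace Y := by
  intro φ
  let R : (E →L[ℝ] ℝ) →L[ℝ] (Y →L[ℝ] ℝ) :=
    (ContinuousLinearMap.compL ℝ Y E ℝ).flip Y.subtypeL
  have hR : ∀ f, R f = f.comp Y.subtypeL := fun f => rfl
  obtain ⟨x, hx⟩ := h.exists_eval (φ.comp R)
  have hxY : x ∈ Y := by
    by_contra hxY
    obtain ⟨f, hf, hfx⟩ := exists_dual_eq_zero_of_notMem Y hY hxY
    apply hfx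
    rw [← hx f, ContinuousLinearMap.comp_apply]
    have : R f = 0 := by
      ext y
      exact hf y y.2
    rw [this, map_zero]
  refine ⟨⟨x, hxY⟩, ?_⟩
  ext g
  obtain ⟨f, hf, -⟩ := exists_extension_norm_eq Y g
  have hg : R f = g := by
    ext y
    exact hf y
  rw [NormedSpace.dual_def, ← hg]
  exact (hx f).symm

/-- The common kernel of a subspace of functionals. -/
def preAnnihilator {E : Type*} [NormedAddCommGroup E] [NormedSpace ℝ E]
    (A : Submodule ℝ (E →L[ℝ] ℝ)) : Submodule ℝ E where
  carrier := {x | ∀ f ∈ A, f x = 0}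
  add_mem' := fun {x y} hx hy f hf => by rw [map_add, hx f hf, hy f hf, add_zero]
  zero_mem' := fun f _ => map_zero f
  smul_mem' := fun c x hx f hf => by rw [map_smul, hx f hf, smul_zero]

theorem isClosed_preAnnihilator {E : Type*} [NormedAddCommGroup E] [NormedSpace ℝ E]
    (A : Submodule ℝ (E →L[ℝ] ℝ)) : IsClosed (preAnnihilator A : Set E) := by
  have : (preAnnihilator A : Set E) = ⋂ f ∈ A, {x | f x = 0} := by
    ext x
    simp [preAnnihilator]
  rw [this]
  exact isClosed_biInter fun f _ => isClosed_eq f.continuous continuous_const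

theorem exists_eq_on_of_angle {E : Type*} [NormedAddCommGroup E] [NormedSpace ℝ E]
    (hE : IsReflexiveSpace E) (A D : Submodule ℝ (E →L[ℝ] ℝ)) (C : ℝ)
    (hAD : ∀ a ∈ A, ∀ d ∈ D, ‖a‖ ≤ C * ‖a + d‖) (y : E) :
    ∃ z ∈ preAnnihilator D, ∀ a ∈ A, a z = a y := by
  have hdisj : Disjoint A D := by
    rw [Submodule.disjoint_def]
    intro a ha hd
    have := hAD a ha (-a) (D.neg_mem hd)
    simpa using this
  let ev : (E →L[ℝ] ℝ) →ₗ[ℝ] ℝ := (NormedSpace.inclusionInDoubleDual ℝ E y).toLinearMap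
  let f : (E →L[ℝ] ℝ) →ₗ.[ℝ] ℝ := ⟨A, ev.domRestrict A⟩
  let g : (E →L[ℝ] ℝ) →ₗ.[ℝ] ℝ := ⟨D, 0⟩
  have H := LinearPMap.sup_h_of_disjoint f g hdisj
  let s := f.sup g H
  have hs : ∀ (a : A) (d : D) (z : s.domain), (a : E →L[ℝ] ℝ) + d = z → s z = a.1 y := by
    intro a d z hz
    have := LinearPMap.sup_apply H a d z hz
    change s z = (a : E →L[ℝ] ℝ) y + 0 at this
    rw [this, add_zero]
  have hbound : ∀ z : s.domain, ‖s z‖ ≤ (C * ‖y‖) * ‖z‖ := by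
    intro z
    have hz : (z : E →L[ℝ] ℝ) ∈ A ⊔ D := z.2
    obtain ⟨a, ha, d, hd, hz⟩ := Submodule.mem_sup.1 hz
    rw [hs ⟨a, ha⟩ ⟨d, hd⟩ z hz]
    calc ‖a y‖ ≤ ‖a‖ * ‖y‖ := a.le_opNorm y
      _ ≤ (C * ‖a + d‖) * ‖y‖ := by gcongr; exact hAD a ha d hd
      _ = (C * ‖y‖) * ‖z‖ := by rw [hz, Submodule.coe_norm]; ring
  obtain ⟨φ, hφ, -⟩ := exists_extension_norm_eq s.domain
    (s.toFun.mkContinuous (C * ‖y‖) hbound)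
  obtain ⟨z, hz⟩ := hE.exists_eval φ
  refine ⟨z, fun d hd => ?_, fun a ha => ?_⟩
  · rw [← hz]
    have hmem : d ∈ s.domain := Submodule.mem_sup_right hd
    have h1 := hφ ⟨d, hmem⟩
    have h2 := hs 0 ⟨d, hd⟩ ⟨d, hmem⟩ (by simp)
    have h3 : (0 : A).1 y = 0 := by simp
    exact h1.trans (h2.trans h3)
  · rw [← hz]
    have hmem : a ∈ s.domain := Submodule.mem_sup_left ha
    have h1 := hφ ⟨a, hmem⟩
    have h2 := hs ⟨a, ha⟩ 0 ⟨a, hmem⟩ (by simp)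
    exact h1.trans h2

theorem not_finiteDimensional_map_mkQ {E : Type*} [NormedAddCommGroup E] [NormedSpace ℝ E]
    (A : Submodule ℝ (E →L[ℝ] ℝ)) (hA : ¬FiniteDimensional ℝ A) (G W : Submodule ℝ E)
    (hG : G ≤ preAnnihilator A) (hW : ∀ y, ∃ z ∈ W, ∀ a ∈ A, a z = a y) :
    ¬FiniteDimensional ℝ (W.map G.mkQ) := by
  intro hfin
  apply hA
  let T : A →ₗ[ℝ] Module.Dual ℝ (W.map G.mkQ) :=
    { toFun := fun a => (G.liftQ a.1.toLinearMap fun x hx => hG hx a.1 a.2).domRestrict _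
      map_add' := fun a b => by
        ext ⟨q, hq⟩
        obtain ⟨x, hx, rfl⟩ := hq
        rfl
      map_smul' := fun c a => by
        ext ⟨q, hq⟩
        obtain ⟨x, hx, rfl⟩ := hq
        rfl }
  refine Module.Finite.of_injective T ?_
  rw [injective_iff_map_eq_zero]
  intro a ha
  ext y
  obtain ⟨z, hz, hzy⟩ := hW y
  have := LinearMap.congr_fun ha ⟨G.mkQ z, Submodule.mem_map_of_mem hz⟩
  rw [← hzy a.1 a.2]
  exact this

theorem isClosed_map_mkQ {E : Type*} [NormedAddCommGroup E] [NormedSpace ℝ E]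
    (G W : Submodule ℝ E) (hGW : G ≤ W) (hW : IsClosed (W : Set E)) :
    IsClosed ((W.map G.mkQ : Submodule ℝ (E ⧸ G)) : Set (E ⧸ G)) := by
  have hq : Topology.IsQuotientMap (G.mkQ : E → E ⧸ G) := G.isOpenQuotientMap_mkQ.isQuotientMap
  rw [← hq.isClosed_preimage]
  have : (G.mkQ ⁻¹' ((W.map G.mkQ : Submodule ℝ (E ⧸ G)) : Set (E ⧸ G))) = W := by
    have h := Submodule.comap_map_mkQ G W
    rw [sup_eq_right.2 hGW] at h
    exact congrArg SetLike.coe h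
  rwa [this]

/-- Two infinite-dimensional subspaces of the dual at positive angle decompose the quotient by
their common kernel. -/
theorem decomposable_quotient_of_angle {E : Type*} [NormedAddCommGroup E] [NormedSpace ℝ E]
    [CompleteSpace E] (hE : IsReflexiveSpace E) (A D : Submodule ℝ (E →L[ℝ] ℝ)) (C : ℝ)
    (hAD : ∀ a ∈ A, ∀ d ∈ D, ‖a‖ ≤ C * ‖a + d‖)
    (hA : ¬FiniteDimensional ℝ A) (hD : ¬FiniteDimensional ℝ D)
    (G : Submodule ℝ E) (hG : G = preAnnihilator A ⊓ preAnnihilator D) :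
    ¬FiniteDimensional ℝ (E ⧸ G) ∧ Decomposable (E ⧸ G) := by
  have hsplit := exists_eq_on_of_angle hE A D C hAD
  have hsplit' : ∀ y, ∃ z ∈ preAnnihilator A, ∀ d ∈ D, d z = d y := by
    intro y
    obtain ⟨z, hz, hzy⟩ := hsplit y
    refine ⟨y - z, fun a ha => ?_, fun d hd => ?_⟩
    · rw [map_sub, hzy a ha, sub_self]
    · rw [map_sub, hz d hd, sub_zero]
  have hGA : G ≤ preAnnihilator A := hG ▸ inf_le_left
  have hGD : G ≤ preAnnihilator D := hG ▸ inf_le_right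
  have hGcl : IsClosed (G : Set E) := by
    rw [hG]
    exact (isClosed_preAnnihilator A).inter (isClosed_preAnnihilator D)
  set U := (preAnnihilator D).map G.mkQ with hU
  set V := (preAnnihilator A).map G.mkQ with hV
  have hUfin : ¬FiniteDimensional ℝ U := not_finiteDimensional_map_mkQ A hA G _ hGA hsplit
  have hVfin : ¬FiniteDimensional ℝ V := not_finiteDimensional_map_mkQ D hD G _ hGD hsplit'
  have hUcl : IsClosed (U : Set (E ⧸ G)) := isClosed_map_mkQ G _ hGD (isClosed_preAnnihilator D)
  have hVcl : IsClosed (V : Set (E ⧸ G)) := isClosed_map_mkQ G _ hGA (isClosed_preAnnihilator A)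
  have hinf : U ⊓ V = ⊥ := by
    rw [eq_bot_iff]
    rintro q ⟨⟨x, hx, rfl⟩, ⟨x', hx', hxx'⟩⟩
    have hmem : x' - x ∈ G := (Submodule.Quotient.eq G).1 hxx'
    have hxA : x ∈ preAnnihilator A := by
      have := (preAnnihilator A).sub_mem hx' (hGA hmem)
      simpa using this
    have hxG : x ∈ G := hG ▸ ⟨hxA, hx⟩
    simpa using hxG
  have hsup : U ⊔ V = ⊤ := by
    rw [eq_top_iff]
    rintro q -
    obtain ⟨y, rfl⟩ := G.mkQ_surjective q
    obtain ⟨z, hz, hzy⟩ := hsplit y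
    have hyz : y - z ∈ preAnnihilator A := fun a ha => by rw [map_sub, hzy a ha, sub_self]
    have : G.mkQ y = G.mkQ z + G.mkQ (y - z) := by rw [← map_add, add_sub_cancel]
    rw [this]
    exact Submodule.add_mem_sup (Submodule.mem_map_of_mem hz) (Submodule.mem_map_of_mem hyz)
  refine ⟨fun hfin => hUfin inferInstance, U, V, hUcl, hVcl, hUfin, hVfin, hsup, hinf, ?_, ?_⟩
  · rw [hsup]
    exact isClosed_univ
  · have hcompl : IsCompl U V := ⟨disjoint_iff.2 hinf, codisjoint_iff.2 hsup⟩
    have : IsClosed (G : Set E) := hGcl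
    let p := U.projectionOntoL V (Submodule.IsCompl.isTopCompl_of_isClosed hcompl hUcl hVcl)
    refine ⟨‖p‖, fun u hu v hv => ?_⟩
    have hp : p (u + v) = ⟨u, hu⟩ := by
      change U.projectionOnto V hcompl (u + v) = ⟨u, hu⟩
      rw [map_add]
      have h1 := Submodule.projectionOnto_apply_left hcompl ⟨u, hu⟩
      have h2 := Submodule.projectionOnto_apply_right hcompl ⟨v, hv⟩
      simp only at h1 h2
      rw [h1, h2, add_zero]
    have := p.le_opNorm (u + v)
    rwa [hp] at this

theorem linearIndependent_of_biorthogonal_maps {E : Type*} [AddCommGroup E] [Module ℝ E]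
    (v : ℕ → E) (T : ℕ → E →ₗ[ℝ] E) (h : ∀ i j, i ≠ j → T i (v j) = 0)
    (hne : ∀ i, T i (v i) ≠ 0) : LinearIndependent ℝ v := by
  rw [linearIndependent_iff']
  intro s g hg i hi
  have := congrArg (T i) hg
  rw [map_zero, map_sum, Finset.sum_eq_single i] at this
  · rw [map_smul] at this
    exact (smul_eq_zero.1 this).resolve_right (hne i)
  · intro j _ hj
    rw [map_smul, h i j hj.symm, smul_zero]
  · exact fun h => absurd hi h

theorem not_finiteDimensional_span_image {E : Type*} [AddCommGroup E] [Module ℝ E]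
    {v : ℕ → E} (hv : LinearIndependent ℝ v) {s : Set ℕ} (hs : s.Infinite) :
    ¬FiniteDimensional ℝ (Submodule.span ℝ (v '' s)) := by
  intro hfin
  have := hs.to_subtype
  have h1 : LinearIndependent ℝ (fun i : s => v i) := hv.comp _ Subtype.val_injective
  have h2 : LinearIndependent ℝ
      (fun i : s => (⟨v i, Submodule.subset_span (Set.mem_image_of_mem v i.2)⟩ :
        Submodule.span ℝ (v '' s))) :=
    LinearIndependent.of_comp (Submodule.span ℝ (v '' s)).subtype h1
  exact not_finite_iff_infinite.2 this h2.finite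

/-- A block sequence close to a sequence split between two subspaces at positive angle is again
split at positive angle. -/
theorem angle_of_perturbation {E : Type*} [NormedAddCommGroup E] [NormedSpace ℝ E]
    (U V : Submodule ℝ E) (C : ℝ) (hC : 0 ≤ C) (hUV : ∀ u ∈ U, ∀ v ∈ V, ‖u‖ ≤ C * ‖u + v‖)
    (s t : Set ℕ) (hst : Disjoint s t) (w z : ℕ → E)
    (hws : ∀ i ∈ s, w i ∈ U) (hwt : ∀ i ∈ t, w i ∈ V)
    (hclose : ∀ i, ‖z i - w i‖ ≤ (1 / 2) ^ (i + 1)) (K : ℝ)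
    (hK : ∀ (c : ℕ →₀ ℝ) i, |c i| ≤ K * ‖Finsupp.linearCombination ℝ z c‖) :
    ∃ C' : ℝ, ∀ a ∈ Submodule.span ℝ (z '' s), ∀ d ∈ Submodule.span ℝ (z '' t),
      ‖a‖ ≤ C' * ‖a + d‖ := by
  have key : ∀ (c : ℕ →₀ ℝ) (R : ℝ), 0 ≤ R → (∀ i, |c i| ≤ R) →
      ‖Finsupp.linearCombination ℝ z c - Finsupp.linearCombination ℝ w c‖ ≤ R := by
    intro c R hR hc
    rw [Finsupp.linearCombination_apply, Finsupp.linearCombination_apply, Finsupp.sum,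
      Finsupp.sum, ← Finset.sum_sub_distrib]
    have hsum : ∑ i ∈ c.support, ((1 : ℝ) / 2) ^ (i + 1) ≤ 1 := by
      have h1 : HasSum (fun i : ℕ => ((1 : ℝ) / 2) ^ (i + 1)) 1 := by
        have := hasSum_geometric_two.mul_right ((1 : ℝ) / 2)
        simpa [pow_succ] using this
      exact sum_le_hasSum _ (fun i _ => by positivity) h1
    calc ‖∑ i ∈ c.support, (c i • z i - c i • w i)‖
        ≤ ∑ i ∈ c.support, ‖c i • z i - c i • w i‖ := norm_sum_le _ _
      _ ≤ ∑ i ∈ c.support, R * (1 / 2) ^ (i + 1) := by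
          refine Finset.sum_le_sum fun i _ => ?_
          rw [← smul_sub, norm_smul, Real.norm_eq_abs]
          exact mul_le_mul (hc i) (hclose i) (norm_nonneg _) hR
      _ = R * ∑ i ∈ c.support, (1 / 2) ^ (i + 1) := by rw [Finset.mul_sum]
      _ ≤ R * 1 := by gcongr
      _ = R := mul_one R
  have hmem : ∀ (W : Submodule ℝ E) (r : Set ℕ) (c : ℕ →₀ ℝ), (∀ i ∈ r, w i ∈ W) →
      c ∈ Finsupp.supported ℝ ℝ r → Finsupp.linearCombination ℝ w c ∈ W := by
    intro W r c hW hc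
    rw [Finsupp.linearCombination_apply, Finsupp.sum]
    exact W.sum_mem fun i hi => W.smul_mem _ (hW i (hc hi))
  refine ⟨C * (1 + 2 * K) + K, fun a ha d hd => ?_⟩
  obtain ⟨c, hc, rfl⟩ := (Finsupp.mem_span_image_iff_linearCombination ℝ).1 ha
  obtain ⟨e, he, rfl⟩ := (Finsupp.mem_span_image_iff_linearCombination ℝ).1 hd
  set M := ‖Finsupp.linearCombination ℝ z c + Finsupp.linearCombination ℝ z e‖ with hM
  have hKM : ∀ i, |(c + e) i| ≤ K * M := by
    intro i
    have := hK (c + e) i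
    rwa [map_add] at this
  have hKM0 : 0 ≤ K * M := (abs_nonneg _).trans (hKM 0)
  have hczero : ∀ i, i ∉ s → c i = 0 := fun i hi =>
    Finsupp.notMem_support_iff.1 fun h => hi (hc h)
  have hezero : ∀ i, i ∉ t → e i = 0 := fun i hi =>
    Finsupp.notMem_support_iff.1 fun h => hi (he h)
  have hcb : ∀ i, |c i| ≤ K * M := by
    intro i
    by_cases hi : i ∈ s
    · have := hKM i
      rwa [Finsupp.add_apply, hezero i (hst.notMem_of_mem_left hi), add_zero] at this
    · rw [hczero i hi, abs_zero]
      exact hKM0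
  have heb : ∀ i, |e i| ≤ K * M := by
    intro i
    by_cases hi : i ∈ t
    · have := hKM i
      rwa [Finsupp.add_apply, hczero i (hst.notMem_of_mem_right hi), zero_add] at this
    · rw [hezero i hi, abs_zero]
      exact hKM0
  have h1 := key c _ hKM0 hcb
  have h2 := key e _ hKM0 heb
  have h3 := hUV _ (hmem U s c hws hc) _ (hmem V t e hwt he)
  set a' := Finsupp.linearCombination ℝ z c
  set d' := Finsupp.linearCombination ℝ z e
  set a := Finsupp.linearCombination ℝ w c
  set d := Finsupp.linearCombination ℝ w e
  have h4 : ‖a'‖ ≤ ‖a‖ + ‖a' - a‖ := by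
    simpa using norm_add_le a (a' - a)
  have h5 : ‖a + d‖ ≤ M + ‖a' - a‖ + ‖d' - d‖ := by
    have : a + d = (a' + d') - (a' - a) - (d' - d) := by abel
    rw [this]
    exact (norm_sub_le _ _).trans (by gcongr; exact norm_sub_le _ _)
  have h6 : C * ‖a + d‖ ≤ C * (M + K * M + K * M) := by
    gcongr
    linarith
  nlinarith

theorem tendsto_comp_of_reflexive {E : Type*} [NormedAddCommGroup E] [NormedSpace ℝ E]
    (hE : IsReflexiveSpace E) (P : ℕ → E →L[ℝ] E) (K : ℝ) (hK : ∀ n, ‖P n‖ ≤ K)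
    (hlim : ∀ y, Tendsto (fun n => P n y) atTop (𝓝 y))
    (hle : ∀ a b, a ≤ b → ∀ y, P a (P b y) = P a y) (f : E →L[ℝ] ℝ) :
    ∀ ε > 0, ∃ N, ∀ n ≥ N, ‖f.comp (P n) - f‖ ≤ ε := by
  intro ε hε
  have hK0 : 0 ≤ K := (norm_nonneg _).trans (hK 0)
  let M : Submodule ℝ (E →L[ℝ] ℝ) :=
    { carrier := {f | ∃ m, ∀ n ≥ m, ∀ y, f (P n y) = f y}
      add_mem' := by
        rintro f g ⟨m, hm⟩ ⟨l, hl⟩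
        refine ⟨max m l, fun n hn y => ?_⟩
        simp [hm n (le_of_max_le_left hn), hl n (le_of_max_le_right hn)]
      zero_mem' := ⟨0, fun _ _ _ => rfl⟩
      smul_mem' := by
        rintro c f ⟨m, hm⟩
        refine ⟨m, fun n hn y => ?_⟩
        simp [hm n hn] }
  have hdense : f ∈ M.topologicalClosure := by
    by_contra hf
    obtain ⟨φ, hφ, hφf⟩ := exists_dual_eq_zero_of_notMem _ M.isClosed_topologicalClosure hf
    obtain ⟨y, hy⟩ := hE.exists_eval φ
    apply hφf
    rw [hy]
    have h0 : ∀ n, f (P n y) = 0 := by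
      intro n
      have hm : f.comp (P n) ∈ M :=
        ⟨n, fun m hm z => congrArg f (hle n m hm z)⟩
      have := hφ _ (M.le_topologicalClosure hm)
      rwa [hy] at this
    have := (f.continuous.tendsto y).comp (hlim y)
    refine tendsto_nhds_unique this ?_
    simp [Function.comp_def, h0]
  have hdense' : f ∈ closure (M : Set (E →L[ℝ] ℝ)) := hdense
  obtain ⟨g, ⟨m, hm⟩, hg⟩ := Metric.mem_closure_iff.1 hdense' (ε / (K + 1)) (by positivity)
  refine ⟨m, fun n hn => ?_⟩
  have hfg : f.comp (P n) - f = (f - g).comp (P n) - (f - g) := by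
    ext y
    simp [hm n hn y]
  rw [dist_eq_norm] at hg
  calc ‖f.comp (P n) - f‖ = ‖(f - g).comp (P n) - (f - g)‖ := by rw [hfg]
    _ ≤ ‖(f - g).comp (P n)‖ + ‖f - g‖ := norm_sub_le _ _
    _ ≤ ‖f - g‖ * K + ‖f - g‖ := by
        gcongr
        exact (ContinuousLinearMap.opNorm_comp_le _ _).trans (by gcongr; exact hK n)
    _ = ‖f - g‖ * (K + 1) := by ring
    _ ≤ (ε / (K + 1)) * (K + 1) := by gcongr
    _ = ε := by field_simp

theorem exists_norm_eq_one_vanishing {E : Type*} [NormedAddCommGroup E] [NormedSpace ℝ E]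
    (U : Submodule ℝ (E →L[ℝ] ℝ)) (hU : ¬FiniteDimensional ℝ U)
    (H : Submodule ℝ E) (hH : FiniteDimensional ℝ H) :
    ∃ u ∈ U, ‖u‖ = 1 ∧ ∀ y ∈ H, u y = 0 := by
  let T : U →ₗ[ℝ] Module.Dual ℝ H :=
    { toFun := fun a => a.1.toLinearMap.domRestrict H
      map_add' := fun _ _ => rfl
      map_smul' := fun _ _ => rfl }
  have hT : ¬Function.Injective T := fun h => hU (Module.Finite.of_injective T h)
  rw [injective_iff_map_eq_zero] at hT
  push Not at hT
  obtain ⟨u, hu, hne⟩ := hT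
  have hne' : ‖u.1‖ ≠ 0 := by
    rw [norm_ne_zero_iff]
    simpa using hne
  refine ⟨‖u.1‖⁻¹ • u.1, U.smul_mem _ u.2, ?_, fun y hy => ?_⟩
  · rw [norm_smul, norm_inv, norm_norm, inv_mul_cancel₀ hne']
  · have : u.1 y = 0 := LinearMap.congr_fun hu ⟨y, hy⟩
    simp [this]

/-- Gliding hump: from two infinite-dimensional subspaces of the dual at positive angle one
extracts a block sequence of functionals whose common kernel has decomposable quotient. -/
theorem exists_block_functionals {E : Type*} [NormedAddCommGroup E] [NormedSpace ℝ E]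
    [CompleteSpace E] (hE : IsReflexiveSpace E) (P : ℕ → E →L[ℝ] E) (K : ℝ)
    (hK : ∀ n, ‖P n‖ ≤ K) (hlim : ∀ y, Tendsto (fun n => P n y) atTop (𝓝 y))
    (hle : ∀ a b, a ≤ b → ∀ y, P a (P b y) = P a y)
    (hge : ∀ a b, a ≤ b → ∀ y, P b (P a y) = P a y)
    (hfin : ∀ n, ∃ H : Submodule ℝ E, FiniteDimensional ℝ H ∧ ∀ y, P n y ∈ H)
    (U V : Submodule ℝ (E →L[ℝ] ℝ)) (C : ℝ) (hUV : ∀ u ∈ U, ∀ v ∈ V, ‖u‖ ≤ C * ‖u + v‖)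
    (hU : ¬FiniteDimensional ℝ U) (hV : ¬FiniteDimensional ℝ V) :
    ∃ (m : ℕ → ℕ) (w : ℕ → E →L[ℝ] ℝ), StrictMono m ∧ m 0 = 0 ∧
      (∀ i y, w i (P (m (i + 1)) y) = w i y) ∧ (∀ i y, w i (P (m i) y) = 0) ∧
      ∀ G : Submodule ℝ E, (∀ y, y ∈ G ↔ ∀ i, w i y = 0) →
        ¬FiniteDimensional ℝ (E ⧸ G) ∧ Decomposable (E ⧸ G) := by
  have hK0 : 0 ≤ K := (norm_nonneg _).trans (hK 0)
  have step : ∀ n l : ℕ, ∃ (u : E →L[ℝ] ℝ) (l' : ℕ), l < l' ∧ u ∈ (if Even n then U else V) ∧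
      ‖u‖ = 1 ∧ (∀ y, u (P l y) = 0) ∧ ‖u.comp (P l') - u‖ ≤ (1 / 2) ^ (n + 1) := by
    intro n l
    obtain ⟨H, hH, hPH⟩ := hfin l
    have hW : ¬FiniteDimensional ℝ (if Even n then U else V : Submodule ℝ (E →L[ℝ] ℝ)) := by
      rcases ite_eq_or_eq (Even n) U V with h | h <;> rwa [h]
    obtain ⟨u, huW, hu1, hu0⟩ := exists_norm_eq_one_vanishing _ hW H hH
    obtain ⟨N, hN⟩ := tendsto_comp_of_reflexive hE P K hK hlim hle u ((1 / 2) ^ (n + 1))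
      (by positivity)
    exact ⟨u, max N (l + 1), (Nat.lt_succ_self l).trans_le (le_max_right _ _), huW, hu1,
      fun y => hu0 _ (hPH y), hN _ (le_max_left _ _)⟩
  choose f L hL hfm hf1 hf0 hfc using step
  let m : ℕ → ℕ := fun n => Nat.rec 0 (fun n l => L n l) n
  have hm : ∀ n, m (n + 1) = L n (m n) := fun n => rfl
  have hmono : StrictMono m := strictMono_nat_of_lt_succ fun n => by
    rw [hm]
    exact hL _ _
  let v : ℕ → E →L[ℝ] ℝ := fun n => f n (m n)
  let w : ℕ → E →L[ℝ] ℝ := fun n => (v n).comp (P (m (n + 1)))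
  have hw : ∀ i y, w i y = v i (P (m (i + 1)) y) := fun i y => rfl
  have hwP : ∀ i y, w i (P (m (i + 1)) y) = w i y := fun i y => by
    rw [hw, hw, hle _ _ le_rfl]
  have hwP0 : ∀ i y, w i (P (m i) y) = 0 := fun i y => by
    rw [hw, hge _ _ (hmono i.lt_succ_self).le]
    exact hf0 _ _ _
  have hclose : ∀ i, ‖w i - v i‖ ≤ (1 / 2) ^ (i + 1) := fun i => hfc i (m i)
  have hwnorm : ∀ i, 1 / 2 ≤ ‖w i‖ := by
    intro i
    have h1 : ‖v i‖ = 1 := hf1 _ _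
    have h2 : ‖v i‖ ≤ ‖w i‖ + ‖w i - v i‖ := by
      have := norm_sub_le (w i) (w i - v i)
      simpa using this
    have h3 : ((1 : ℝ) / 2) ^ (i + 1) ≤ 1 / 2 := by
      rw [pow_succ]
      have : ((1 : ℝ) / 2) ^ i ≤ 1 := pow_le_one₀ (by norm_num) (by norm_num)
      linarith
    linarith [hclose i]
  let Δ : ℕ → E →L[ℝ] E := fun i => P (m (i + 1)) - P (m i)
  have hΔ : ∀ i y, Δ i y = P (m (i + 1)) y - P (m i) y := fun i y => rfl
  have hΔnorm : ∀ i, ‖Δ i‖ ≤ 2 * K := fun i => by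
    refine (norm_sub_le _ _).trans ?_
    linarith [hK (m (i + 1)), hK (m i)]
  have hwΔ : ∀ i, (w i).comp (Δ i) = w i := by
    intro i
    ext y
    rw [ContinuousLinearMap.comp_apply, hΔ, map_sub, hwP, hwP0, sub_zero]
  have hwlo : ∀ i l y, l ≤ i → w i (P (m l) y) = 0 := by
    intro i l y hl
    rw [← hge _ _ (hmono.monotone hl) y, hwP0]
  have hwhi : ∀ i l y, i + 1 ≤ l → w i (P (m l) y) = w i y := by
    intro i l y hl
    rw [← hwP i (P (m l) y), hle _ _ (hmono.monotone hl) y, hwP]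
  have hwΔ' : ∀ i j, i ≠ j → (w j).comp (Δ i) = 0 := by
    intro i j hij
    ext y
    rw [ContinuousLinearMap.comp_apply, hΔ, map_sub]
    rcases lt_or_gt_of_ne hij with h | h
    · rw [hwlo j _ y h, hwlo j _ y h.le, sub_zero]
      rfl
    · rw [hwhi j _ y h, hwhi j _ y (Nat.le_succ_of_le h), sub_self]
      rfl
  let T : ℕ → (E →L[ℝ] ℝ) →ₗ[ℝ] (E →L[ℝ] ℝ) := fun i =>
    { toFun := fun g => g.comp (Δ i)
      map_add' := fun _ _ => rfl
      map_smul' := fun _ _ => rfl }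
  have hTw : ∀ i j, i ≠ j → T i (w j) = 0 := hwΔ'
  have hTw' : ∀ i, T i (w i) = w i := hwΔ
  have hlin : LinearIndependent ℝ w := by
    refine linearIndependent_of_biorthogonal_maps w T hTw fun i => ?_
    rw [hTw', ← norm_ne_zero_iff]
    linarith [hwnorm i]
  have hcoef : ∀ (c : ℕ →₀ ℝ) i, |c i| ≤ (4 * K) * ‖Finsupp.linearCombination ℝ w c‖ := by
    intro c i
    have h1 : T i (Finsupp.linearCombination ℝ w c) = c i • w i := by
      rw [Finsupp.linearCombination_apply, Finsupp.sum, map_sum, Finset.sum_eq_single i]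
      · rw [map_smul, hTw']
      · intro j _ hj
        rw [map_smul, hTw i j hj.symm, smul_zero]
      · intro hi
        rw [Finsupp.notMem_support_iff.1 hi, zero_smul, map_zero]
    have h2 : ‖T i (Finsupp.linearCombination ℝ w c)‖ ≤
        ‖Finsupp.linearCombination ℝ w c‖ * (2 * K) :=
      (ContinuousLinearMap.opNorm_comp_le _ _).trans (by gcongr; exact hΔnorm i)
    rw [h1, norm_smul, Real.norm_eq_abs] at h2
    nlinarith [hwnorm i, abs_nonneg (c i)]
  have hUV' : ∀ u ∈ U, ∀ v ∈ V, ‖u‖ ≤ |C| * ‖u + v‖ := fun u hu v hv =>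
    (hUV u hu v hv).trans (by gcongr; exact le_abs_self C)
  obtain ⟨C', hC'⟩ := angle_of_perturbation U V |C| (abs_nonneg C) hUV' {i | Even i} {i | ¬Even i}
    (Set.disjoint_left.2 fun i hi hi' => hi' hi) v w
    (fun i (hi : Even i) => by simpa [hi] using hfm i (m i))
    (fun i (hi : ¬Even i) => by simpa only [hi, if_false] using hfm i (m i)) hclose (4 * K) hcoef
  refine ⟨m, w, hmono, rfl, hwP, hwP0, fun G hG => ?_⟩
  refine decomposable_quotient_of_angle hE _ _ C' hC'
    (not_finiteDimensional_span_image hlin ?_) (not_finiteDimensional_span_image hlin ?_) G ?_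
  · exact Set.infinite_of_injective_forall_mem (f := fun n : ℕ => 2 * n)
      (fun a b h => by simpa using h) fun n => even_two_mul n
  · exact Set.infinite_of_injective_forall_mem (f := fun n : ℕ => 2 * n + 1)
      (fun a b h => by simpa using h) fun n => by simp
  · ext y
    have hspan : ∀ s : Set ℕ, y ∈ preAnnihilator (Submodule.span ℝ (w '' s)) ↔
        ∀ i ∈ s, w i y = 0 := by
      intro s
      refine ⟨fun h i hi => h _ (Submodule.subset_span ⟨i, hi, rfl⟩), fun h g hg => ?_⟩
      induction hg using Submodule.span_induction with
      | mem x hx =>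
        obtain ⟨i, hi, rfl⟩ := hx
        exact h i hi
      | zero => rfl
      | add a b _ _ ha hb => rw [add_apply, ha, hb, add_zero]
      | smul c a _ ha => rw [smul_apply, ha, smul_zero]
    rw [hG, Submodule.mem_inf, hspan, hspan]
    refine ⟨fun h => ⟨fun i _ => h i, fun i _ => h i⟩, fun h i => ?_⟩
    by_cases hi : Even i
    · exact h.1 i hi
    · exact h.2 i hi

theorem finiteDimensional_biSup_finset {E : Type*} [AddCommGroup E] [Module ℝ E]
    {B : ℕ → Submodule ℝ E} (hB : ∀ n, FiniteDimensional ℝ (B n)) (s : Finset ℕ) :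
    FiniteDimensional ℝ (⨆ i ∈ s, B i : Submodule ℝ E) := by
  rw [← Finset.sup_eq_iSup]
  exact Submodule.finiteDimensional_finset_sup s B

/-- The partial sum operators of an FDD are uniformly bounded. -/
theorem IsFDD.exists_partialSums {E : Type*} [NormedAddCommGroup E] [NormedSpace ℝ E]
    [CompleteSpace E] {B : ℕ → Submodule ℝ E} (hB : IsFDD B) :
    ∃ (S : ℕ → E →L[ℝ] E) (K : ℝ), (∀ n, ‖S n‖ ≤ K) ∧
      (∀ x, Tendsto (fun n => S n x) atTop (𝓝 x)) ∧
      (∀ n i, i < n → ∀ x ∈ B i, S n x = x) ∧ (∀ n i, n ≤ i → ∀ x ∈ B i, S n x = 0) := by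
  obtain ⟨-, hfin, hexp⟩ := hB
  choose b hb huniq using hexp
  simp only at hb huniq
  let s : E → ℕ → E := fun x N => ∑ n ∈ Finset.range N, (b x n : E)
  have hs : ∀ x, Tendsto (s x) atTop (𝓝 x) := hb
  have hbs : ∀ (x : E) (c : (n : ℕ) → B n),
      Tendsto (fun N => ∑ n ∈ Finset.range N, (c n : E)) atTop (𝓝 x) →
      ∀ N, ∑ n ∈ Finset.range N, (c n : E) = s x N := by
    intro x c hc N
    rw [huniq x c hc]
  have hadd : ∀ x y N, s (x + y) N = s x N + s y N := by
    intro x y N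
    have := hbs (x + y) (fun n => b x n + b y n) (by
      have := (hs x).add (hs y)
      simpa [s, Finset.sum_add_distrib] using this) N
    rw [← this]
    simp [s, Finset.sum_add_distrib]
  have hsmul : ∀ (r : ℝ) x N, s (r • x) N = r • s x N := by
    intro r x N
    have := hbs (r • x) (fun n => r • b x n) (by
      have := (hs x).const_smul r
      simpa [s, Finset.smul_sum] using this) N
    rw [← this]
    simp [s, Finset.smul_sum]
  have hbdd : ∀ x, ∃ C, ∀ N, ‖s x N‖ ≤ C := by
    intro x
    obtain ⟨C, hC⟩ := (Metric.isBounded_range_of_tendsto _ (hs x)).exists_norm_le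
    exact ⟨C, fun N => hC _ ⟨N, rfl⟩⟩
  choose C hC using hbdd
  let T : E →ₗ[ℝ] BoundedContinuousFunction ℕ E :=
    { toFun := fun x => BoundedContinuousFunction.ofNormedAddCommGroupDiscrete (s x) (C x) (hC x)
      map_add' := fun x y => by
        ext N
        exact hadd x y N
      map_smul' := fun r x => by
        ext N
        exact hsmul r x N }
  have hT : ∀ x N, T x N = s x N := fun x N => rfl
  have hTc : Continuous T := by
    refine T.continuous_of_seq_closed_graph fun u x y hu hy => ?_
    have hyN : ∀ N, Tendsto (fun j => s (u j) N) atTop (𝓝 (y N)) := by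
      intro N
      exact ((continuous_eval_const (F := BoundedContinuousFunction ℕ E) N).tendsto y).comp hy
    have hmem : ∀ N, y (N + 1) - y N ∈ B N := by
      intro N
      have := hfin N
      refine (B N).closed_of_finiteDimensional.mem_of_tendsto ((hyN (N + 1)).sub (hyN N))
        (Eventually.of_forall fun j => ?_)
      simp [s, Finset.sum_range_succ]
    have hy0 : y 0 = 0 := tendsto_nhds_unique (hyN 0) (by simp [s])
    have hsum : ∀ N, ∑ n ∈ Finset.range N, (y (n + 1) - y n) = y N := fun N => by
      rw [Finset.sum_range_sub, hy0, sub_zero]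
    have hyx : Tendsto (fun N => y N) atTop (𝓝 x) := by
      rw [Metric.tendsto_atTop]
      intro ε hε
      obtain ⟨j, hj1, hj2⟩ := ((Metric.tendsto_nhds.1 hu (ε / 3) (by positivity)).and
        (Metric.tendsto_nhds.1 hy (ε / 3) (by positivity))).exists
      obtain ⟨N, hN⟩ := Metric.tendsto_atTop.1 (hs (u j)) (ε / 3) (by positivity)
      refine ⟨N, fun n hn => ?_⟩
      have h1 : dist (s (u j) n) (y n) < ε / 3 :=
        (BoundedContinuousFunction.dist_coe_le_dist n).trans_lt hj2
      calc dist (y n) x ≤ dist (y n) (s (u j) n) + dist (s (u j) n) (u j) + dist (u j) x :=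
            dist_triangle4 _ _ _ _
        _ < ε / 3 + ε / 3 + ε / 3 := by
            rw [dist_comm (y n)]
            gcongr
            exact hN n hn
        _ = ε := by ring
    ext N
    have := hbs x (fun n => ⟨y (n + 1) - y n, hmem n⟩) (by simpa only [hsum] using hyx) N
    rw [hT, ← this]
    exact (hsum N).symm
  let T' : E →L[ℝ] BoundedContinuousFunction ℕ E := ⟨T, hTc⟩
  have hbound : ∀ N x, ‖s x N‖ ≤ ‖T'‖ * ‖x‖ := fun N x =>
    ((T x).norm_coe_le_norm N).trans (T'.le_opNorm x)
  let S : ℕ → E →L[ℝ] E := fun N =>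
    LinearMap.mkContinuous ⟨⟨fun x => s x N, fun x y => hadd x y N⟩, fun r x => hsmul r x N⟩
      ‖T'‖ (hbound N)
  have hS : ∀ N x, S N x = s x N := fun N x => rfl
  have hsingle : ∀ i, ∀ x ∈ B i, ∀ N, s x N = if i < N then x else 0 := by
    intro i x hx N
    have hc : ∀ N, ∑ n ∈ Finset.range N, ((Pi.single i (⟨x, hx⟩ : B i) : (n : ℕ) → B n) n : E) =
        if i < N then x else 0 := by
      intro N
      have : ∀ n, ((Pi.single i (⟨x, hx⟩ : B i) : (n : ℕ) → B n) n : E) =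
          if i = n then x else 0 := by
        intro n
        by_cases h : i = n
        · subst h
          simp
        · rw [Pi.single_eq_of_ne (Ne.symm h), if_neg h]
          rfl
      simp [this]
    rw [← hbs x (Pi.single i ⟨x, hx⟩) ?_ N, hc]
    simp only [hc]
    refine tendsto_const_nhds.congr' ?_
    filter_upwards [eventually_gt_atTop i] with n hn
    rw [if_pos hn]
  refine ⟨S, ‖T'‖, fun N => LinearMap.mkContinuous_norm_le _ (norm_nonneg _) _, hs, ?_, ?_⟩
  · intro n i hi x hx
    rw [hS, hsingle i x hx, if_pos hi]
  · intro n i hi x hx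
    rw [hS, hsingle i x hx, if_neg hi.not_gt]

theorem RestrictedQHI.not_decomposable_quotient {E : Type*} [NormedAddCommGroup E]
    [NormedSpace ℝ E] {B : ℕ → Submodule ℝ E} (h : RestrictedQHI B) {k : ℕ → ℕ}
    (hk : SuccPartition k) (F G : ℕ → Submodule ℝ E) (hGF : ∀ n, G n ≤ F n)
    (hF : ∀ n, F n ≤ ⨆ i ∈ Finset.Ico (k n) (k (n + 1)), B i) (Y : Submodule ℝ E)
    (hY : Y = (⨆ n, F n).topologicalClosure) (H : Submodule ℝ Y)
    (hH : H = ((⨆ n, G n).topologicalClosure).comap Y.subtype)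
    (hfin : ¬FiniteDimensional ℝ (Y ⧸ H)) : ¬Decomposable (Y ⧸ H) := by
  subst hY hH
  exact h k hk F G hGF hF hfin

/-- Under the restricted QHI property, no two infinite-dimensional subspaces of the dual of an
FDD-block subspace are at positive angle. -/
theorem not_angle_dual_of_restrictedQHI {E : Type*} [NormedAddCommGroup E] [NormedSpace ℝ E]
    [CompleteSpace E] (hrefl : IsReflexiveSpace E) {B : ℕ → Submodule ℝ E} (hB : IsFDD B)
    (hQHI : RestrictedQHI B) {Y : Submodule ℝ E} (hYblock : IsFDDBlockSubspace B Y)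
    (U V : Submodule ℝ (Y →L[ℝ] ℝ)) (hU : ¬FiniteDimensional ℝ U) (hV : ¬FiniteDimensional ℝ V)
    (C : ℝ) : ¬∀ u ∈ U, ∀ v ∈ V, ‖u‖ ≤ C * ‖u + v‖ := by
  intro hUV
  obtain ⟨k, hk, F, hF, hY⟩ := hYblock
  obtain ⟨S, K, hSK, hSlim, hSid, hSzero⟩ := hB.exists_partialSums
  have hBfin := hB.2.1
  have hYcl : IsClosed (Y : Set E) := hY ▸ Submodule.isClosed_topologicalClosure _
  have hYcomplete : CompleteSpace Y := hYcl.completeSpace_coe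
  have hFY : ∀ n, F n ≤ Y := fun n =>
    hY ▸ (le_iSup F n).trans (Submodule.le_topologicalClosure _)
  have hFfin : ∀ n, FiniteDimensional ℝ (F n) := fun n =>
    have := finiteDimensional_biSup_finset hBfin (Finset.Ico (k n) (k (n + 1)))
    Submodule.finiteDimensional_of_le (hF n)
  let A : ℕ → ℕ → Submodule ℝ E := fun a b => ⨆ j ∈ Finset.Ico a b, F j
  have hAfin : ∀ a b, FiniteDimensional ℝ (A a b) := fun a b =>
    finiteDimensional_biSup_finset hFfin _
  have hAY : ∀ a b, A a b ≤ Y := fun a b => iSup₂_le fun j _ => hFY j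
  have hFid : ∀ n j, j < n → ∀ x ∈ F j, S (k n) x = x := by
    intro n j hj
    suffices F j ≤ LinearMap.eqLocus (S (k n)).toLinearMap LinearMap.id from this
    refine (hF j).trans (iSup₂_le fun i hi x hx => ?_)
    exact hSid _ _ ((Finset.mem_Ico.1 hi).2.trans_le (hk.1.monotone hj)) x hx
  have hFzero : ∀ n j, n ≤ j → ∀ x ∈ F j, S (k n) x = 0 := by
    intro n j hj
    suffices F j ≤ LinearMap.ker (S (k n)).toLinearMap from this
    refine (hF j).trans (iSup₂_le fun i hi x hx => ?_)
    exact hSzero _ _ ((hk.1.monotone hj).trans (Finset.mem_Ico.1 hi).1) x hx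
  have hAid : ∀ a b c, b ≤ c → ∀ x ∈ A a b, S (k c) x = x := by
    intro a b c hbc
    suffices A a b ≤ LinearMap.eqLocus (S (k c)).toLinearMap LinearMap.id from this
    refine iSup₂_le fun j hj x hx => ?_
    exact hFid _ _ ((Finset.mem_Ico.1 hj).2.trans_le hbc) x hx
  have hAzero : ∀ a b c, c ≤ a → ∀ x ∈ A a b, S (k c) x = 0 := by
    intro a b c hbc
    suffices A a b ≤ LinearMap.ker (S (k c)).toLinearMap from this
    refine iSup₂_le fun j hj x hx => ?_
    exact hFzero _ _ (hbc.trans (Finset.mem_Ico.1 hj).1) x hx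
  have hdiff : ∀ a b, a ≤ b → ∀ y ∈ Y, S (k b) y - S (k a) y ∈ A a b := by
    intro a b hab
    suffices Y ≤ (A a b).comap (S (k b) - S (k a)).toLinearMap from this
    rw [hY]
    refine Submodule.topologicalClosure_minimal _ (iSup_le fun j x hx => ?_) ?_
    · change S (k b) x - S (k a) x ∈ A a b
      rcases lt_or_ge j a with h | h
      · rw [hFid a j h x hx, hFid b j (h.trans_le hab) x hx, sub_self]
        exact zero_mem _
      · rw [hFzero a j h x hx, sub_zero]
        rcases lt_or_ge j b with h' | h'
        · rw [hFid b j h' x hx]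
          exact Submodule.mem_iSup_of_mem j
            (Submodule.mem_iSup_of_mem (Finset.mem_Ico.2 ⟨h, h'⟩) hx)
        · rw [hFzero b j h' x hx]
          exact zero_mem _
    · exact (A a b).closed_of_finiteDimensional.preimage (S (k b) - S (k a)).continuous
  have hS0 : ∀ y ∈ Y, S (k 0) y = 0 := by
    intro y hy
    suffices Y ≤ LinearMap.ker (S (k 0)).toLinearMap from this hy
    rw [hY]
    refine Submodule.topologicalClosure_minimal _ (iSup_le fun j x hx => ?_)
      (S (k 0)).isClosed_ker
    exact hFzero 0 j j.zero_le x hx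
  have hSA : ∀ n, ∀ y ∈ Y, S (k n) y ∈ A 0 n := by
    intro n y hy
    have := hdiff 0 n n.zero_le y hy
    rwa [hS0 y hy, sub_zero] at this
  let P : ℕ → Y →L[ℝ] Y := fun n =>
    ((S (k n)).comp Y.subtypeL).codRestrict Y fun y => hAY _ _ (hSA n y y.2)
  have hP : ∀ n (y : Y), (P n y : E) = S (k n) y := fun n y => rfl
  have hPK : ∀ n, ‖P n‖ ≤ K := fun n =>
    ContinuousLinearMap.opNorm_le_bound _ ((norm_nonneg _).trans (hSK 0)) fun y =>
      ((S (k n)).le_opNorm (y : E)).trans (mul_le_mul_of_nonneg_right (hSK _) (norm_nonneg (y : E)))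
  have hPlim : ∀ y, Tendsto (fun n => P n y) atTop (𝓝 y) := fun y =>
    tendsto_subtype_rng.2 ((hSlim y).comp hk.1.tendsto_atTop)
  have hPge : ∀ a b, a ≤ b → ∀ y, P b (P a y) = P a y := fun a b hab y =>
    Subtype.ext (hAid 0 a b hab _ (hSA a y y.2))
  have hPle : ∀ a b, a ≤ b → ∀ y, P a (P b y) = P a y := by
    intro a b hab y
    have h1 := hAzero a b a le_rfl _ (hdiff a b hab y y.2)
    rw [map_sub, sub_eq_zero] at h1
    rw [← hPge a a le_rfl y]
    exact Subtype.ext h1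
  have hPfin : ∀ n, ∃ H : Submodule ℝ Y, FiniteDimensional ℝ H ∧ ∀ y, P n y ∈ H := by
    intro n
    refine ⟨(A 0 n).comap Y.subtype, ?_, fun y => hSA n y y.2⟩
    exact Module.Finite.equiv (Submodule.comapSubtypeEquivOfLe (hAY 0 n)).symm
  obtain ⟨m, w, hm, hm0, hw1, hw0, hdec⟩ := exists_block_functionals (hrefl.submodule Y hYcl) P K
    hPK hPlim hPle hPge hPfin U V C hUV hU hV
  let F' : ℕ → Submodule ℝ E := fun n => A (m n) (m (n + 1))
  let G' : ℕ → Submodule ℝ E := fun n => F' n ⊓ (LinearMap.ker (w n).toLinearMap).map Y.subtype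
  have hk' : SuccPartition (k ∘ m) :=
    ⟨hk.1.comp hm, by rw [Function.comp_apply, hm0, hk.2]⟩
  have hF' : ∀ n, F' n ≤ ⨆ i ∈ Finset.Ico ((k ∘ m) n) ((k ∘ m) (n + 1)), B i := by
    intro n
    refine iSup₂_le fun j hj => (hF j).trans (biSup_mono fun i hi => ?_)
    rw [Finset.mem_Ico] at hi hj ⊢
    exact ⟨(hk.1.monotone hj.1).trans hi.1, hi.2.trans_le (hk.1.monotone hj.2)⟩
  have hYF' : Y = (⨆ n, F' n).topologicalClosure := by
    have : ⨆ n, F' n = ⨆ n, F n := by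
      refine le_antisymm (iSup_le fun n => iSup₂_le fun j _ => le_iSup F j) (iSup_le fun j => ?_)
      obtain ⟨n, hn1, hn2⟩ : ∃ n, m n ≤ j ∧ j < m (n + 1) := by
        have hex : ∃ n, j < m n := ⟨j + 1, (Nat.lt_succ_self j).trans_le (hm.id_le _)⟩
        have hpos : Nat.find hex ≠ 0 := by
          intro h0
          have := Nat.find_spec hex
          rw [h0, hm0] at this
          exact absurd this (Nat.not_lt_zero j)
        obtain ⟨n, hn⟩ := Nat.exists_eq_succ_of_ne_zero hpos
        refine ⟨n, not_lt.1 (Nat.find_min hex (by omega)), ?_⟩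
        have := Nat.find_spec hex
        rwa [hn] at this
      exact le_iSup_of_le n (le_iSup₂_of_le j (Finset.mem_Ico.2 ⟨hn1, hn2⟩) le_rfl)
    rw [this, hY]
  let H : Submodule ℝ Y := ((⨆ n, G' n).topologicalClosure).comap Y.subtype
  have hH : ∀ y, y ∈ H ↔ ∀ i, w i y = 0 := by
    intro y
    constructor
    · intro hy i
      have hcl : IsClosed (((LinearMap.ker (w i).toLinearMap).map Y.subtype : Submodule ℝ E) :
          Set E) := hYcl.isClosedMap_subtype_val _ (w i).isClosed_ker
      have hle : (⨆ n, G' n).topologicalClosure ≤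
          (LinearMap.ker (w i).toLinearMap).map Y.subtype := by
        refine Submodule.topologicalClosure_minimal _ (iSup_le fun n x hx => ?_) hcl
        obtain ⟨hxF, z, hz, rfl⟩ := hx
        refine ⟨z, ?_, rfl⟩
        have hz : w n z = 0 := hz
        change w i z = 0
        rcases lt_trichotomy i n with h | h | h
        · have : P (m (i + 1)) z = 0 := Subtype.ext (hAzero _ _ _ (hm.monotone h) _ hxF)
          rw [← hw1, this, map_zero]
        · rw [h, hz]
        · have : P (m i) z = z := Subtype.ext (hAid _ _ _ (hm.monotone h) _ hxF)
          rw [← this, hw0]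
      obtain ⟨z, hz, hzy⟩ := hle hy
      have : z = y := Subtype.ext hzy
      exact this ▸ hz
    · intro hy
      have hmem : ∀ n, S (k (m n)) y ∈ ⨆ n, G' n := by
        intro n
        induction n with
        | zero =>
          rw [hm0, hS0 y y.2]
          exact zero_mem _
        | succ n ih =>
          have hd := hdiff _ _ (hm.monotone n.le_succ) y y.2
          have hG : S (k (m (n + 1))) y - S (k (m n)) y ∈ G' n := by
            refine ⟨hd, P (m (n + 1)) y - P (m n) y, ?_, rfl⟩
            change w n (P (m (n + 1)) y - P (m n) y) = 0
            rw [map_sub, hw1, hw0, hy n, sub_zero]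
          have := add_mem (Submodule.mem_iSup_of_mem n hG) ih
          rwa [sub_add_cancel] at this
      exact mem_closure_of_tendsto
        ((hSlim y).comp (hk.1.comp hm).tendsto_atTop) (Eventually.of_forall hmem)
  obtain ⟨hfin, hdecomp⟩ := hdec H hH
  exact hQHI.not_decomposable_quotient hk' F' G' (fun n => inf_le_left) hF' Y hYF' H rfl hfin
    hdecomp

theorem isHI_of_not_angle {E : Type*} [NormedAddCommGroup E] [NormedSpace ℝ E]
    (hE : ¬FiniteDimensional ℝ E)
    (h : ∀ U V : Submodule ℝ E, ¬FiniteDimensional ℝ U → ¬FiniteDimensional ℝ V → ∀ C : ℝ,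
      ¬∀ u ∈ U, ∀ v ∈ V, ‖u‖ ≤ C * ‖u + v‖) : IsHI E := by
  refine ⟨hE, fun Z _ hdec => ?_⟩
  obtain ⟨U, V, -, -, hU, hV, -, -, -, C, hC⟩ := hdec
  have hmap : ∀ W : Submodule ℝ Z, ¬FiniteDimensional ℝ W →
      ¬FiniteDimensional ℝ (W.map Z.subtype) := fun W hW hfin =>
    hW (Module.Finite.equiv (Submodule.equivMapOfInjective _ Z.subtype_injective W).symm)
  refine h _ _ (hmap U hU) (hmap V hV) C ?_
  rintro _ ⟨u, hu, rfl⟩ _ ⟨v, hv, rfl⟩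
  exact hC u hu v hv

theorem not_finiteDimensional_dual {E : Type*} [NormedAddCommGroup E] [NormedSpace ℝ E]
    (hE : ¬FiniteDimensional ℝ E) : ¬FiniteDimensional ℝ (E →L[ℝ] ℝ) := by
  intro hfin
  apply hE
  let T : E →ₗ[ℝ] Module.Dual ℝ (E →L[ℝ] ℝ) :=
    { toFun := fun x => (NormedSpace.inclusionInDoubleDual ℝ E x).toLinearMap
      map_add' := fun x y => by
        ext f
        simp
      map_smul' := fun c x => by
        ext f
        simp }
  refine Module.Finite.of_injective T ?_
  rw [injective_iff_map_eq_zero]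
  intro x hx
  exact SeparatingDual.eq_zero_of_forall_dual_eq_zero (R := ℝ) fun f => LinearMap.congr_fun hx f

theorem IsFDD.not_finiteDimensional {E : Type*} [NormedAddCommGroup E] [NormedSpace ℝ E]
    [CompleteSpace E] {B : ℕ → Submodule ℝ E} (hB : IsFDD B) : ¬FiniteDimensional ℝ E := by
  intro hfin
  obtain ⟨S, -, -, -, hSid, hSzero⟩ := hB.exists_partialSums
  choose v hv hv0 using fun n => Submodule.exists_mem_ne_zero_of_ne_bot (hB.1 n)
  have hlin : LinearIndependent ℝ v := by
    refine linearIndependent_of_biorthogonal_maps v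
      (fun i => (S (i + 1) - S i).toLinearMap) (fun i j hij => ?_) fun i => ?_
    · change S (i + 1) (v j) - S i (v j) = 0
      rcases lt_or_gt_of_ne hij with h | h
      · rw [hSzero _ j h _ (hv j), hSzero _ j h.le _ (hv j), sub_self]
      · rw [hSid _ j h _ (hv j), hSid _ j (Nat.lt_succ_of_lt h) _ (hv j), sub_self]
    · change S (i + 1) (v i) - S i (v i) ≠ 0
      rw [hSid _ i i.lt_succ_self _ (hv i), hSzero _ i le_rfl _ (hv i), sub_zero]
      exact hv0 i
  exact not_finite_iff_infinite.2 (inferInstanceAs (Infinite ℕ)) hlin.finite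

theorem IsFDD.isFDDBlockSubspace_top {E : Type*} [NormedAddCommGroup E] [NormedSpace ℝ E]
    {B : ℕ → Submodule ℝ E} (hB : IsFDD B) : IsFDDBlockSubspace B (⊤ : Submodule ℝ E) := by
  refine ⟨id, ⟨strictMono_id, rfl⟩, B, fun n => ?_, ?_⟩
  · exact le_iSup₂_of_le n (Finset.mem_Ico.2 ⟨le_rfl, n.lt_succ_self⟩) le_rfl
  · refine (eq_top_iff.2 fun x _ => ?_).symm
    obtain ⟨b, hb, -⟩ := hB.2.2 x
    exact mem_closure_of_tendsto hb (Eventually.of_forall fun N =>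
      Submodule.sum_mem _ fun n _ => Submodule.mem_iSup_of_mem n (b n).2)

/-- Let `X` be a reflexive Banach space with a finite-dimensional decomposition which has the
restricted QHI property. Then the dual of every infinite-dimensional FDD-block subspace of `X`
is hereditarily indecomposable; in particular `X^*` is hereditarily indecomposable. -/
theorem dual_HI_of_restrictedQHI (X : Type*) [NormedAddCommGroup X] [NormedSpace ℝ X]
    [CompleteSpace X] (hrefl : IsReflexiveSpace X)
    (B : ℕ → Submodule ℝ X) (hB : IsFDD B) (hQHI : RestrictedQHI B) :
    (∀ Y : Submodule ℝ X, IsFDDBlockSubspace B Y → ¬FiniteDimensional ℝ Y →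
      IsHI (↥Y →L[ℝ] ℝ)) ∧
    IsHI (X →L[ℝ] ℝ) := by
  refine ⟨fun Y hY hfin => isHI_of_not_angle (not_finiteDimensional_dual hfin)
    (not_angle_dual_of_restrictedQHI hrefl hB hQHI hY),
    isHI_of_not_angle (not_finiteDimensional_dual hB.not_finiteDimensional) ?_⟩
  intro U V hU hV C hC
  let R : (X →L[ℝ] ℝ) →ₗ[ℝ] ((⊤ : Submodule ℝ X) →L[ℝ] ℝ) :=
    { toFun := fun f => f.comp (⊤ : Submodule ℝ X).subtypeL
      map_add' := fun _ _ => rfl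
      map_smul' := fun _ _ => rfl }
  have hR : ∀ f, ‖R f‖ = ‖f‖ := by
    intro f
    refine le_antisymm (ContinuousLinearMap.opNorm_le_bound _ (norm_nonneg f) fun x =>
      f.le_opNorm x) (ContinuousLinearMap.opNorm_le_bound _ (R f).opNorm_nonneg fun x => ?_)
    exact (R f).le_opNorm ⟨x, trivial⟩
  have hinj : Function.Injective R := by
    rw [injective_iff_map_eq_zero]
    intro f hf
    ext x
    exact congrArg (fun g : (⊤ : Submodule ℝ X) →L[ℝ] ℝ => g ⟨x, trivial⟩) hf
  have hmap : ∀ W : Submodule ℝ (X →L[ℝ] ℝ), ¬FiniteDimensional ℝ W →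
      ¬FiniteDimensional ℝ (W.map R) := fun W hW hfin =>
    hW (Module.Finite.equiv (Submodule.equivMapOfInjective R hinj W).symm)
  refine not_angle_dual_of_restrictedQHI hrefl hB hQHI hB.isFDDBlockSubspace_top _ _
    (hmap U hU) (hmap V hV) C ?_
  rintro _ ⟨u, hu, rfl⟩ _ ⟨v, hv, rfl⟩
  rw [← map_add, hR, hR]
  exact hC u hu v hv

end
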